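/- Let X be a Polish space, r ≥ 1, and μ, μ^k (k ∈ ℕ) probability measures on X with finite r-th moments such that μ^k converges weakly to μ. Then W_r(μ^k, μ) → 0 if and only if sup_k I^r_ε(μ^k) → 0 as ε → 0 and sup_k ∫ d(x,x₀)^r dμ^k < ∞. -/

import Mathlib

open MeasureTheory

/-- `I^r_ε(μ) = sup { ∫ d(x,x₀)^r dτ : τ ≤ μ, τ(X) ≤ ε }`. -/
noncomputable def Ieps {X : Type*} [MetricSpace X] [MeasurableSpace X]
    (r : ℝ) (x₀ : X) (μ : Measure X) (ε : ℝ) : ℝ :=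
  sSup {c : ℝ | ∃ τ : Measure X, τ ≤ μ ∧ τ Set.univ ≤ ENNReal.ofReal ε ∧
    c = ∫ x, dist x x₀ ^ r ∂τ}

/-- `W_r^r(μ,ν) = inf { ∫ d(x,y)^r dπ : π ∈ Π(μ,ν) }`. -/
noncomputable def WrRpow {X : Type*} [MetricSpace X] [MeasurableSpace X]
    (r : ℝ) (μ ν : Measure X) : ℝ :=
  sInf {c : ℝ | ∃ π : Measure (X × X), π.map Prod.fst = μ ∧ π.map Prod.snd = ν ∧
    c = ∫ p, dist p.1 p.2 ^ r ∂π}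

namespace WassAux

open Filter Topology Set

lemma dist_rpow_le {X : Type*} [MetricSpace X] {r : ℝ} (hr : 1 ≤ r) (x y z : X) :
    dist x y ^ r ≤ 2 ^ r * (dist x z ^ r + dist y z ^ r) := by
  have hr0 : 0 ≤ r := by linarith
  have h1 : dist x y ≤ 2 * max (dist x z) (dist y z) := by
    have := dist_triangle_right x y z
    have := le_max_left (dist x z) (dist y z)
    have := le_max_right (dist x z) (dist y z)
    linarith
  have hx : 0 ≤ dist x z ^ r := by positivity
  have hy : 0 ≤ dist y z ^ r := by positivity
  calc dist x y ^ r ≤ (2 * max (dist x z) (dist y z)) ^ r :=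
        Real.rpow_le_rpow dist_nonneg h1 hr0
    _ = 2 ^ r * max (dist x z) (dist y z) ^ r := by
        rw [Real.mul_rpow (by norm_num) (by positivity)]
    _ ≤ _ := by
        gcongr
        rcases max_choice (dist x z) (dist y z) with h | h <;> rw [h] <;> linarith

variable {X : Type*} [MetricSpace X] [SecondCountableTopology X] [MeasurableSpace X] [BorelSpace X]

lemma exists_prod_coupling (α β : Measure X) [IsFiniteMeasure α] [IsFiniteMeasure β]
    (h : α univ = β univ) :
    ∃ Q : Measure (X × X), Q.map Prod.fst = α ∧ Q.map Prod.snd = β := by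
  by_cases h0 : α univ = 0
  · have ha : α = 0 := Measure.measure_univ_eq_zero.mp h0
    have hb : β = 0 := Measure.measure_univ_eq_zero.mp (h ▸ h0)
    exact ⟨0, by simp [ha], by simp [hb]⟩
  · refine ⟨(α univ)⁻¹ • α.prod β, ?_, ?_⟩
    · rw [Measure.map_smul, Measure.map_fst_prod, ← h, smul_smul,
        ENNReal.inv_mul_cancel h0 (measure_ne_top _ _), one_smul]
    · rw [Measure.map_smul, Measure.map_snd_prod, smul_smul,
        ENNReal.inv_mul_cancel h0 (measure_ne_top _ _), one_smul]

lemma meas_g (r : ℝ) (x₀ : X) : Measurable (fun x : X => dist x x₀ ^ r) := by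
  fun_prop

lemma meas_d (r : ℝ) : Measurable (fun p : X × X => dist p.1 p.2 ^ r) := by
  fun_prop

lemma le_Ieps {r : ℝ} {x₀ : X} {μ τ : Measure X} {ε : ℝ}
    (hμ : Integrable (fun x => dist x x₀ ^ r) μ) (h : τ ≤ μ)
    (hτ : τ univ ≤ ENNReal.ofReal ε) : ∫ x, dist x x₀ ^ r ∂τ ≤ Ieps r x₀ μ ε := by
  refine le_csSup ⟨∫ x, dist x x₀ ^ r ∂μ, ?_⟩ ⟨τ, h, hτ, rfl⟩
  rintro c ⟨σ, hσ, -, rfl⟩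
  exact integral_mono_measure hσ (Eventually.of_forall fun x => by positivity) hμ

lemma Ieps_nonneg (r : ℝ) (x₀ : X) (μ : Measure X) (ε : ℝ) : 0 ≤ Ieps r x₀ μ ε := by
  refine Real.sSup_nonneg ?_
  rintro c ⟨σ, hσ, -, rfl⟩
  exact integral_nonneg fun x => by positivity

lemma WrRpow_nonneg (r : ℝ) (μ ν : Measure X) : 0 ≤ WrRpow r μ ν := by
  refine Real.sInf_nonneg ?_
  rintro c ⟨σ, hσ, -, rfl⟩
  exact integral_nonneg fun x => by positivity

lemma WrRpow_le {r : ℝ} (hr : 1 ≤ r) (x₀ : X) (μ ν : Measure X)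
    [IsProbabilityMeasure μ] [IsProbabilityMeasure ν]
    (hμ : Integrable (fun x => dist x x₀ ^ r) μ) (hν : Integrable (fun x => dist x x₀ ^ r) ν)
    (S : Measure (X × X)) (h1 : S.map Prod.fst ≤ μ) (h2 : S.map Prod.snd ≤ ν)
    {ε δ : ℝ} (hδ : 0 ≤ δ) (hmass : 1 ≤ S univ + ENNReal.ofReal ε)
    (hd : ∀ᵐ p ∂S, dist p.1 p.2 ≤ δ) :
    WrRpow r μ ν ≤ δ ^ r + 2 ^ r * (Ieps r x₀ μ ε + Ieps r x₀ ν ε) := by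
  have hr0 : 0 ≤ r := by linarith
  have e1 : (S.map Prod.fst) univ = S univ := by
    rw [Measure.map_apply measurable_fst MeasurableSet.univ, preimage_univ]
  have e2 : (S.map Prod.snd) univ = S univ := by
    rw [Measure.map_apply measurable_snd MeasurableSet.univ, preimage_univ]
  have hS1 : S univ ≤ 1 := by
    rw [← e1]; exact (h1 univ).trans prob_le_one
  have hSt : S univ ≠ ⊤ := ne_top_of_le_ne_top ENNReal.one_ne_top hS1
  have : IsFiniteMeasure S := ⟨hSt.lt_top⟩
  set α := μ - S.map Prod.fst with hα
  set β := ν - S.map Prod.snd with hβ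
  have ha : α + S.map Prod.fst = μ := Measure.sub_add_cancel_of_le h1
  have hb : β + S.map Prod.snd = ν := Measure.sub_add_cancel_of_le h2
  have haμ : α ≤ μ := Measure.sub_le
  have hbν : β ≤ ν := Measure.sub_le
  have : IsFiniteMeasure α := isFiniteMeasure_of_le μ haμ
  have : IsFiniteMeasure β := isFiniteMeasure_of_le ν hbν
  have ma : α univ + S univ = 1 := by
    rw [← e1, ← Measure.add_apply, ha, measure_univ]
  have mb : β univ + S univ = 1 := by
    rw [← e2, ← Measure.add_apply, hb, measure_univ]
  have mab : α univ = β univ := (ENNReal.add_left_inj hSt).mp (ma.trans mb.symm)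
  have mae : α univ ≤ ENNReal.ofReal ε := by
    rw [← ma, add_comm] at hmass
    exact (ENNReal.add_le_add_iff_left hSt).mp hmass
  obtain ⟨Q, hQ1, hQ2⟩ := exists_prod_coupling α β mab
  have hI1 := le_Ieps hμ haμ mae
  have hI2 := le_Ieps hν hbν (mab ▸ mae)
  have hn1 := Ieps_nonneg r x₀ μ ε
  have hn2 := Ieps_nonneg r x₀ ν ε
  have key : WrRpow r μ ν ≤ ∫ p, dist p.1 p.2 ^ r ∂(Q + S) := by
    refine csInf_le ⟨0, ?_⟩ ⟨Q + S, ?_, ?_, rfl⟩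
    · rintro c ⟨σ, hσ, -, rfl⟩
      exact integral_nonneg fun x => by positivity
    · rw [Measure.map_add _ _ measurable_fst, hQ1, ha]
    · rw [Measure.map_add _ _ measurable_snd, hQ2, hb]
  refine key.trans ?_
  rw [integral_eq_lintegral_of_nonneg_ae (Eventually.of_forall fun x => by positivity)
    (meas_d r).aestronglyMeasurable]
  refine ENNReal.toReal_le_of_le_ofReal (by positivity) ?_
  rw [lintegral_add_measure, add_comm, ENNReal.ofReal_add (by positivity) (by positivity)]
  have hmG : Measurable (fun x : X => ENNReal.ofReal (dist x x₀ ^ r)) :=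
    (meas_g r x₀).ennreal_ofReal
  gcongr
  · calc ∫⁻ p, ENNReal.ofReal (dist p.1 p.2 ^ r) ∂S ≤ ∫⁻ p, ENNReal.ofReal (δ ^ r) ∂S := by
          refine lintegral_mono_ae ?_
          filter_upwards [hd] with p hp
          gcongr
      _ = ENNReal.ofReal (δ ^ r) * S univ := by simp
      _ ≤ ENNReal.ofReal (δ ^ r) * 1 := by gcongr
      _ = _ := mul_one _
  · calc ∫⁻ p, ENNReal.ofReal (dist p.1 p.2 ^ r) ∂Q
        ≤ ∫⁻ p, ENNReal.ofReal (2 ^ r) * (ENNReal.ofReal (dist p.1 x₀ ^ r)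
            + ENNReal.ofReal (dist p.2 x₀ ^ r)) ∂Q := by
          refine lintegral_mono fun p => ?_
          rw [← ENNReal.ofReal_add (by positivity) (by positivity),
            ← ENNReal.ofReal_mul (by positivity)]
          exact ENNReal.ofReal_le_ofReal (dist_rpow_le hr _ _ _)
      _ = ENNReal.ofReal (2 ^ r) * (∫⁻ x, ENNReal.ofReal (dist x x₀ ^ r) ∂α
            + ∫⁻ x, ENNReal.ofReal (dist x x₀ ^ r) ∂β) := by
          rw [lintegral_const_mul _ (by fun_prop), lintegral_add_left (by fun_prop)]
          congr 2
          · rw [← hQ1, lintegral_map hmG measurable_fst]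
          · rw [← hQ2, lintegral_map hmG measurable_snd]
      _ = ENNReal.ofReal (2 ^ r * (∫ x, dist x x₀ ^ r ∂α + ∫ x, dist x x₀ ^ r ∂β)) := by
          rw [← ofReal_integral_eq_lintegral_ofReal (hμ.mono_measure haμ)
              (Eventually.of_forall fun x => by positivity),
            ← ofReal_integral_eq_lintegral_ofReal (hν.mono_measure hbν)
              (Eventually.of_forall fun x => by positivity),
            ← ENNReal.ofReal_add (integral_nonneg fun x => by positivity)
              (integral_nonneg fun x => by positivity),
            ← ENNReal.ofReal_mul (by positivity)]
      _ ≤ _ := by gcongr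

lemma integrable_tail {r : ℝ} {x₀ : X} {μ : Measure X} [IsFiniteMeasure μ]
    (hμ : Integrable (fun x => dist x x₀ ^ r) μ) (A : ℝ) :
    Integrable (fun x => max (dist x x₀ ^ r - A) 0) μ :=
  (hμ.sub (integrable_const A)).sup (integrable_zero _ _ _)

lemma Ieps_le {r : ℝ} {x₀ : X} {μ : Measure X} [IsFiniteMeasure μ]
    (hμ : Integrable (fun x => dist x x₀ ^ r) μ) {A ε : ℝ} (hA : 0 ≤ A) (hε : 0 ≤ ε) :
    Ieps r x₀ μ ε ≤ A * ε + ∫ x, max (dist x x₀ ^ r - A) 0 ∂μ := by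
  refine csSup_le ⟨0, 0, Measure.zero_le _, by simp, by simp⟩ ?_
  rintro c ⟨τ, hτ, hτε, rfl⟩
  have : IsFiniteMeasure τ := isFiniteMeasure_of_le μ hτ
  have hit := (integrable_tail hμ A).mono_measure hτ
  calc ∫ x, dist x x₀ ^ r ∂τ ≤ ∫ x, (A + max (dist x x₀ ^ r - A) 0) ∂τ := by
        refine integral_mono (hμ.mono_measure hτ) ((integrable_const A).add hit) fun x => ?_
        have := le_max_left (dist x x₀ ^ r - A) 0
        simp only
        linarith
    _ = A * τ.real univ + ∫ x, max (dist x x₀ ^ r - A) 0 ∂τ := by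
        rw [integral_add (integrable_const A) hit]
        simp [mul_comm]
    _ ≤ _ := by
        gcongr
        · exact ENNReal.toReal_le_of_le_ofReal hε hτε
        · exact Eventually.of_forall fun x => le_max_right _ _
        · exact integrable_tail hμ A

lemma tendsto_tail {r : ℝ} {x₀ : X} {μ : Measure X} [IsFiniteMeasure μ]
    (hμ : Integrable (fun x => dist x x₀ ^ r) μ) :
    Tendsto (fun A : ℝ => ∫ x, max (dist x x₀ ^ r - A) 0 ∂μ) atTop (𝓝 0) := by
  have : Tendsto (fun A : ℝ => ∫ x, max (dist x x₀ ^ r - A) 0 ∂μ) atTop (𝓝 (∫ x, (0:ℝ) ∂μ)) := by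
    refine tendsto_integral_filter_of_dominated_convergence (fun x => dist x x₀ ^ r) ?_ ?_ hμ ?_
    · exact Eventually.of_forall fun A => (integrable_tail hμ A).aestronglyMeasurable
    · filter_upwards [eventually_ge_atTop 0] with A hA
      refine Eventually.of_forall fun x => ?_
      have : 0 ≤ dist x x₀ ^ r := by positivity
      rw [Real.norm_of_nonneg (le_max_right _ _)]
      exact max_le (by linarith) this
    · refine Eventually.of_forall fun x => ?_
      refine tendsto_const_nhds.congr' ?_
      filter_upwards [eventually_ge_atTop (dist x x₀ ^ r)] with A hA
      rw [max_eq_right (by linarith)]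
  simpa using this

lemma tail_le {r : ℝ} (hr : 1 ≤ r) {x₀ : X} {μ ν : Measure X}
    [IsProbabilityMeasure μ] [IsProbabilityMeasure ν]
    (hμ : Integrable (fun x => dist x x₀ ^ r) μ) (hν : Integrable (fun x => dist x x₀ ^ r) ν)
    {A : ℝ} (hA : 0 ≤ A) :
    ∫ x, max (dist x x₀ ^ r - A) 0 ∂μ ≤ 2 ^ r * WrRpow r μ ν
      + 2 ^ r * ∫ x, max (dist x x₀ ^ r - A / 2 ^ r) 0 ∂ν := by
  have hc : (0:ℝ) < 2 ^ r := by positivity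
  suffices h : (∫ x, max (dist x x₀ ^ r - A) 0 ∂μ
      - 2 ^ r * ∫ x, max (dist x x₀ ^ r - A / 2 ^ r) 0 ∂ν) / 2 ^ r ≤ WrRpow r μ ν by
    rw [div_le_iff₀ hc] at h
    linarith
  refine le_csInf ?_ ?_
  · exact ⟨_, μ.prod ν, by simp, by simp, rfl⟩
  rintro c ⟨π, h1, h2, rfl⟩
  rw [div_le_iff₀ hc]
  have i1 : Integrable (fun p : X × X => dist p.1 x₀ ^ r) π := by
    rw [← h1] at hμ
    exact hμ.comp_measurable measurable_fst
  have i2 : Integrable (fun p : X × X => dist p.2 x₀ ^ r) π := by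
    rw [← h2] at hν
    exact hν.comp_measurable measurable_snd
  have it1 : Integrable (fun p : X × X => max (dist p.1 x₀ ^ r - A) 0) π := by
    have := integrable_tail hμ A
    rw [← h1] at this
    exact this.comp_measurable measurable_fst
  have it2 : Integrable (fun p : X × X => max (dist p.2 x₀ ^ r - A / 2 ^ r) 0) π := by
    have := integrable_tail hν (A / 2 ^ r)
    rw [← h2] at this
    exact this.comp_measurable measurable_snd
  have id : Integrable (fun p : X × X => dist p.1 p.2 ^ r) π := by
    refine ((i1.add i2).const_mul (2 ^ r)).mono' (meas_d r).aestronglyMeasurable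
      (Eventually.of_forall fun p => ?_)
    rw [Real.norm_of_nonneg (by positivity)]
    exact dist_rpow_le hr _ _ _
  have em : ∫ x, max (dist x x₀ ^ r - A) 0 ∂μ = ∫ p, max (dist p.1 x₀ ^ r - A) 0 ∂π := by
    rw [← h1, integral_map measurable_fst.aemeasurable]
    exact (((meas_g r x₀).sub_const A).max measurable_const).aestronglyMeasurable
  have en : ∫ x, max (dist x x₀ ^ r - A / 2 ^ r) 0 ∂ν
      = ∫ p, max (dist p.2 x₀ ^ r - A / 2 ^ r) 0 ∂π := by
    rw [← h2, integral_map measurable_snd.aemeasurable]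
    exact (((meas_g r x₀).sub_const _).max measurable_const).aestronglyMeasurable
  rw [em, en]
  have hle : ∫ p, max (dist p.1 x₀ ^ r - A) 0 ∂π ≤ ∫ p, (2 ^ r * dist p.1 p.2 ^ r
      + 2 ^ r * max (dist p.2 x₀ ^ r - A / 2 ^ r) 0) ∂π := by
    refine integral_mono it1 ((id.const_mul _).add (it2.const_mul _)) fun p => ?_
    have hp := dist_rpow_le hr p.1 x₀ p.2
    rw [dist_comm x₀ p.2, mul_add] at hp
    have hm := le_max_left (dist p.2 x₀ ^ r - A / 2 ^ r) 0
    have hm0 := le_max_right (dist p.2 x₀ ^ r - A / 2 ^ r) 0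
    have hm' := mul_le_mul_of_nonneg_left hm hc.le
    rw [mul_sub, mul_div_cancel₀ _ hc.ne'] at hm'
    refine max_le (by linarith) (by positivity)
  rw [integral_add (id.const_mul _) (it2.const_mul _), integral_const_mul, integral_const_mul] at hle
  linarith

lemma exists_disjoint_open (μ : Measure X) [IsProbabilityMeasure μ] [Nonempty X]
    {δ : ℝ} (hδ : 0 < δ) :
    ∃ U : ℕ → Set X, (∀ n, IsOpen (U n)) ∧ Pairwise (Function.onFun Disjoint U) ∧
      (∀ n, ∀ x ∈ U n, ∀ y ∈ U n, dist x y ≤ δ) ∧ μ (⋃ n, U n) = 1 := by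
  obtain ⟨xs, hxs⟩ := TopologicalSpace.exists_dense_seq X
  have hrad : ∀ n, ∃ ρ ∈ Ioo (δ / 4) (δ / 2), μ (frontier (Metric.thickening ρ {xs n})) = 0 :=
    fun n => exists_null_frontier_thickening μ {xs n} (by linarith)
  choose ρ hρ hfr using hrad
  simp only [Metric.thickening_singleton] at hfr
  set B : ℕ → Set X := fun n => Metric.ball (xs n) (ρ n) with hB
  set U : ℕ → Set X := fun n => B n ∩ ⋂ i ∈ Finset.range n, (closure (B i))ᶜ with hU
  refine ⟨U, fun n => ?_, ?_, ?_, ?_⟩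
  · exact Metric.isOpen_ball.inter
      (isOpen_biInter_finset fun i _ => isClosed_closure.isOpen_compl)
  · have hlt : ∀ m n, m < n → Disjoint (U m) (U n) := by
      intro m n hmn
      rw [Set.disjoint_left]
      intro x hx hx'
      have := hx'.2
      simp only [Finset.mem_range, mem_iInter] at this
      exact this m hmn (subset_closure hx.1)
    intro m n hmn
    rcases lt_or_gt_of_ne hmn with h | h
    · exact hlt m n h
    · exact (hlt n m h).symm
  · intro n x hx y hy
    have h1 : dist x (xs n) < ρ n := hx.1
    have h2 : dist y (xs n) < ρ n := hy.1
    have := dist_triangle_right x y (xs n)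
    have := (hρ n).2
    linarith
  · rw [prob_compl_eq_zero_iff (MeasurableSet.iUnion fun n => (Metric.isOpen_ball.inter
      (isOpen_biInter_finset fun i _ => isClosed_closure.isOpen_compl)).measurableSet) |>.symm]
    refine measure_mono_null ?_ (measure_iUnion_null hfr)
    intro x hx
    by_contra hcon
    simp only [mem_iUnion, not_exists] at hcon
    apply hx
    have hex : ∃ n, x ∈ B n := by
      obtain ⟨n, hn⟩ := hxs.exists_dist_lt x (show 0 < δ / 4 by linarith)
      exact ⟨n, hn.trans (hρ n).1⟩
    classical
    refine mem_iUnion.mpr ⟨Nat.find hex, Nat.find_spec hex, ?_⟩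
    simp only [Finset.mem_range, mem_iInter]
    intro i hi hcl
    have hnot := Nat.find_min hex hi
    apply hcon i
    rw [frontier, Metric.isOpen_ball.interior_eq]
    exact ⟨hcl, hnot⟩

lemma exists_subcoupling (μ : Measure X) (μk : ℕ → Measure X) [IsProbabilityMeasure μ]
    [∀ k, IsProbabilityMeasure (μk k)]
    (hweak : ∀ f : BoundedContinuousFunction X ℝ,
      Tendsto (fun k => ∫ x, f x ∂(μk k)) atTop (𝓝 (∫ x, f x ∂μ)))
    {δ : ℝ} (hδ : 0 < δ) :
    ∀ᶠ k in atTop, ∃ S : Measure (X × X), S.map Prod.fst ≤ μk k ∧ S.map Prod.snd ≤ μ ∧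
      1 ≤ S univ + ENNReal.ofReal δ ∧ ∀ᵐ p ∂S, dist p.1 p.2 ≤ δ := by
  have : Nonempty X := nonempty_of_isProbabilityMeasure μ
  obtain ⟨U, hUo, hUd, hUδ, hU1⟩ := exists_disjoint_open μ hδ
  have hUm : ∀ n, MeasurableSet (U n) := fun n => (hUo n).measurableSet
  -- finitely many sets suffice
  obtain ⟨N, hN⟩ : ∃ N, 1 ≤ ∑ n ∈ Finset.range N, μ (U n) + ENNReal.ofReal (δ / 2) := by
    rw [measure_iUnion hUd hUm] at hU1
    have ht := ENNReal.summable.hasSum (f := fun n => μ (U n)) |>.tendsto_sum_nat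
    rw [hU1] at ht
    have hlt : (1 : ENNReal) - ENNReal.ofReal (δ / 2) < 1 :=
      ENNReal.sub_lt_self ENNReal.one_ne_top one_ne_zero
        (ENNReal.ofReal_pos.mpr (by linarith)).ne'
    obtain ⟨N, hN⟩ := (ht.eventually (lt_mem_nhds hlt)).exists
    exact ⟨N, tsub_le_iff_right.mp hN.le⟩
  set η : ℝ := δ / 2 / (N + 1) with hη
  have hη0 : 0 < η := by positivity
  let P : ProbabilityMeasure X := ⟨μ, inferInstance⟩
  let Pk : ℕ → ProbabilityMeasure X := fun k => ⟨μk k, inferInstance⟩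
  have htend : Tendsto Pk atTop (𝓝 P) :=
    ProbabilityMeasure.tendsto_iff_forall_integral_tendsto.mpr hweak
  have hev : ∀ᶠ k in atTop, ∀ n ∈ Finset.range N, μ (U n) < μk k (U n) + ENNReal.ofReal η := by
    rw [Finset.eventually_all]
    intro n _
    exact htend (ProbabilityMeasure.toMeasure_add_pos_gt_mem_nhds P (hUo n)
      (ENNReal.ofReal_pos.mpr hη0))
  filter_upwards [hev] with k hk
  set p : ℕ → ENNReal := fun n => μk k (U n) with hp
  set q : ℕ → ENNReal := fun n => μ (U n) with hq
  have hpt : ∀ n, p n ≠ ⊤ := fun n => measure_ne_top _ _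
  have hqt : ∀ n, q n ≠ ⊤ := fun n => measure_ne_top _ _
  -- scaling factors
  set t : ℕ → ENNReal := fun n => (max (p n) (q n))⁻¹ with htdef
  have htq : ∀ n, t n * q n ≤ 1 := fun n => by
    calc t n * q n ≤ (max (p n) (q n))⁻¹ * max (p n) (q n) := by
          simp only [htdef]; gcongr; exact le_max_right _ _
      _ ≤ 1 := ENNReal.inv_mul_le_one _
  have htp : ∀ n, t n * p n ≤ 1 := fun n => by
    calc t n * p n ≤ (max (p n) (q n))⁻¹ * max (p n) (q n) := by
          simp only [htdef]; gcongr; exact le_max_left _ _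
      _ ≤ 1 := ENNReal.inv_mul_le_one _
  have htm : ∀ n, min (p n) (q n) ≤ t n * (p n * q n) := fun n => by
    by_cases h0 : max (p n) (q n) = 0
    · have : p n = 0 := le_antisymm ((le_max_left _ _).trans h0.le) bot_le
      simp [this]
    · rw [← max_mul_min (p n) (q n), ← mul_assoc]
      simp only [htdef]
      rw [ENNReal.inv_mul_cancel h0 (by simp [hpt n, hqt n]), one_mul]
  have hrestr : ∀ (ν : Measure X) (c : ℕ → ENNReal), (∀ n, c n ≤ 1) →
      ∑ n ∈ Finset.range N, c n • ν.restrict (U n) ≤ ν := by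
    intro ν c hc
    have hsum : ν.restrict (⋃ n ∈ Finset.range N, U n)
        = ∑ n ∈ Finset.range N, ν.restrict (U n) := by
      ext s hs
      rw [Measure.restrict_apply hs, Measure.finsetSum_apply, inter_iUnion₂,
        measure_biUnion_finset]
      · exact Finset.sum_congr rfl fun n _ => (Measure.restrict_apply hs).symm
      · intro i _ j _ hij
        exact (hUd hij).mono inter_subset_right inter_subset_right
      · exact fun n _ => hs.inter (hUm n)
    calc ∑ n ∈ Finset.range N, c n • ν.restrict (U n)
        ≤ ∑ n ∈ Finset.range N, ν.restrict (U n) := by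
          refine Finset.sum_le_sum fun n _ => ?_
          refine Measure.le_iff'.mpr fun s => ?_
          rw [Measure.smul_apply, smul_eq_mul]
          exact mul_le_of_le_one_left bot_le (hc n)
      _ = ν.restrict (⋃ n ∈ Finset.range N, U n) := hsum.symm
      _ ≤ ν := Measure.restrict_le_self
  refine ⟨∑ n ∈ Finset.range N, t n • ((μk k).restrict (U n)).prod (μ.restrict (U n)),
    ?_, ?_, ?_, ?_⟩
  · have : (∑ n ∈ Finset.range N, t n • ((μk k).restrict (U n)).prod (μ.restrict (U n))).map
        Prod.fst = ∑ n ∈ Finset.range N, (t n * q n) • (μk k).restrict (U n) := by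
      rw [← Measure.mapₗ_apply_of_measurable measurable_fst, map_sum]
      refine Finset.sum_congr rfl fun n _ => ?_
      rw [Measure.mapₗ_apply_of_measurable measurable_fst, Measure.map_smul,
        Measure.map_fst_prod, smul_smul, Measure.restrict_apply_univ]
    rw [this]
    exact hrestr _ _ htq
  · have : (∑ n ∈ Finset.range N, t n • ((μk k).restrict (U n)).prod (μ.restrict (U n))).map
        Prod.snd = ∑ n ∈ Finset.range N, (t n * p n) • μ.restrict (U n) := by
      rw [← Measure.mapₗ_apply_of_measurable measurable_snd, map_sum]
      refine Finset.sum_congr rfl fun n _ => ?_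
      rw [Measure.mapₗ_apply_of_measurable measurable_snd, Measure.map_smul,
        Measure.map_snd_prod, smul_smul, Measure.restrict_apply_univ]
    rw [this]
    exact hrestr _ _ htp
  · have hmass : (∑ n ∈ Finset.range N, t n • ((μk k).restrict (U n)).prod (μ.restrict (U n))) univ
        = ∑ n ∈ Finset.range N, t n * (p n * q n) := by
      rw [Measure.finsetSum_apply]
      refine Finset.sum_congr rfl fun n _ => ?_
      rw [Measure.smul_apply, smul_eq_mul, ← univ_prod_univ, Measure.prod_prod,
        Measure.restrict_apply_univ, Measure.restrict_apply_univ]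
    rw [hmass]
    calc (1 : ENNReal) ≤ ∑ n ∈ Finset.range N, q n + ENNReal.ofReal (δ / 2) := hN
      _ ≤ ∑ n ∈ Finset.range N, (t n * (p n * q n) + ENNReal.ofReal η)
            + ENNReal.ofReal (δ / 2) := by
          gcongr with n hn
          refine le_trans ?_ (add_le_add_left (htm n) _)
          rcases le_total (p n) (q n) with h | h
          · rw [min_eq_left h]; exact (hk n hn).le
          · rw [min_eq_right h]; exact le_self_add
      _ = ∑ n ∈ Finset.range N, t n * (p n * q n)
            + (N * ENNReal.ofReal η + ENNReal.ofReal (δ / 2)) := by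
          rw [Finset.sum_add_distrib, add_assoc]
          simp
      _ ≤ _ := by
          gcongr
          rw [← ENNReal.ofReal_natCast, ← ENNReal.ofReal_mul (by positivity),
            ← ENNReal.ofReal_add (by positivity) (by positivity)]
          refine ENNReal.ofReal_le_ofReal ?_
          have : (N : ℝ) * η ≤ δ / 2 := by
            have h : ((N : ℝ) + 1) * η = δ / 2 := by rw [hη]; field_simp
            linarith
          linarith
  · rw [ae_iff, Measure.finsetSum_apply]
    refine Finset.sum_eq_zero fun n _ => ?_
    rw [Measure.smul_apply, smul_eq_mul]
    refine mul_eq_zero_of_right _ ?_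
    rw [Measure.prod_restrict, ← ae_iff]
    filter_upwards [ae_restrict_mem ((hUm n).prod (hUm n))] with z hz
    exact hUδ n _ hz.1 _ hz.2

lemma forward (r : ℝ) (hr : 1 ≤ r) (x₀ : X)
    (μ : Measure X) (μk : ℕ → Measure X)
    [IsProbabilityMeasure μ] [∀ k, IsProbabilityMeasure (μk k)]
    (hmom : Integrable (fun x => dist x x₀ ^ r) μ)
    (hmomk : ∀ k, Integrable (fun x => dist x x₀ ^ r) (μk k))
    (hW : Tendsto (fun k => WrRpow r (μk k) μ) atTop (𝓝 0)) :
      Tendsto (fun ε => ⨆ k, Ieps r x₀ (μk k) ε) (𝓝[>] 0) (𝓝 0) ∧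
        ∃ C : ℝ, ∀ k, ∫ x, dist x x₀ ^ r ∂(μk k) ≤ C := by
  have hc : (0:ℝ) < 2 ^ r := by positivity
  constructor
  · rw [Metric.tendsto_nhds]
    intro η hη
    have hWs : ∀ᶠ k in atTop, 2 ^ r * WrRpow r (μk k) μ < η / 4 := by
      have := hW.const_mul (2 ^ r)
      rw [mul_zero] at this
      exact this.eventually (gt_mem_nhds (by linarith))
    obtain ⟨K, hK⟩ := eventually_atTop.mp hWs
    have hT : ∀ᶠ A : ℝ in atTop, 2 ^ r * ∫ x, max (dist x x₀ ^ r - A / 2 ^ r) 0 ∂μ < η / 4 := by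
      have := ((tendsto_tail hmom).comp (tendsto_id.atTop_div_const hc)).const_mul (2 ^ r)
      rw [mul_zero] at this
      exact this.eventually (gt_mem_nhds (by linarith))
    have hTk : ∀ᶠ A : ℝ in atTop, ∀ k ∈ Finset.range K,
        ∫ x, max (dist x x₀ ^ r - A) 0 ∂(μk k) < η / 2 := by
      rw [Finset.eventually_all]
      exact fun k _ => (tendsto_tail (hmomk k)).eventually (gt_mem_nhds (by linarith))
    obtain ⟨A, hA0, hA1, hA2⟩ := ((eventually_ge_atTop 0).and (hT.and hTk)).exists
    have hAll : ∀ k, ∫ x, max (dist x x₀ ^ r - A) 0 ∂(μk k) ≤ η / 2 := by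
      intro k
      by_cases hkK : k < K
      · exact (hA2 k (Finset.mem_range.mpr hkK)).le
      · have h1 := hK k (not_lt.mp hkK)
        have h2 := tail_le hr (hmomk k) hmom hA0
        linarith
    have hε : ∀ᶠ ε : ℝ in 𝓝[>] 0, A * ε < η / 4 := by
      have : Tendsto (fun ε : ℝ => A * ε) (𝓝 0) (𝓝 (A * 0)) := tendsto_id.const_mul A
      rw [mul_zero] at this
      exact (this.mono_left nhdsWithin_le_nhds).eventually (gt_mem_nhds (by linarith))
    filter_upwards [hε, self_mem_nhdsWithin] with ε hε1 hε0
    rw [Real.dist_eq, sub_zero, abs_of_nonneg (Real.iSup_nonneg fun k => Ieps_nonneg _ _ _ _)]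
    refine lt_of_le_of_lt (ciSup_le fun k => ?_) (show 3 * η / 4 < η by linarith)
    have h1 := Ieps_le (hmomk k) hA0 (le_of_lt hε0)
    have h2 := hAll k
    linarith
  · obtain ⟨M, hM⟩ := hW.bddAbove_range
    refine ⟨2 ^ r * M + 2 ^ r * ∫ x, dist x x₀ ^ r ∂μ, fun k => ?_⟩
    have h := tail_le hr (hmomk k) hmom (le_refl 0)
    have hm : ∀ x : X, max (dist x x₀ ^ r) 0 = dist x x₀ ^ r := fun x =>
      max_eq_left (by positivity)
    simp only [zero_div, sub_zero, hm] at h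
    have hMk : WrRpow r (μk k) μ ≤ M := hM ⟨k, rfl⟩
    have := mul_le_mul_of_nonneg_left hMk hc.le
    linarith

lemma backward (r : ℝ) (hr : 1 ≤ r) (x₀ : X)
    (μ : Measure X) (μk : ℕ → Measure X)
    [IsProbabilityMeasure μ] [∀ k, IsProbabilityMeasure (μk k)]
    (hmom : Integrable (fun x => dist x x₀ ^ r) μ)
    (hmomk : ∀ k, Integrable (fun x => dist x x₀ ^ r) (μk k))
    (hweak : ∀ f : BoundedContinuousFunction X ℝ,
      Tendsto (fun k => ∫ x, f x ∂(μk k)) atTop (𝓝 (∫ x, f x ∂μ)))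
    (hI : Tendsto (fun ε => ⨆ k, Ieps r x₀ (μk k) ε) (𝓝[>] 0) (𝓝 0))
    (hC : ∃ C : ℝ, ∀ k, ∫ x, dist x x₀ ^ r ∂(μk k) ≤ C) :
    Tendsto (fun k => WrRpow r (μk k) μ) atTop (𝓝 0) := by
  obtain ⟨C, hC⟩ := hC
  have hIμ : Tendsto (fun ε => Ieps r x₀ μ ε) (𝓝[>] 0) (𝓝 0) :=
    by
      have hWself : Tendsto (fun ε => ⨆ _ : ℕ, Ieps r x₀ μ ε) (𝓝[>] 0) (𝓝 0) := by
        refine (forward r hr x₀ μ (fun _ => μ) hmom (fun _ => hmom) ?_).1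
        have : WrRpow r μ μ = 0 := by
          refine le_antisymm ?_ (WrRpow_nonneg _ _ _)
          refine csInf_le ⟨0, ?_⟩ ⟨μ.map (fun x => (x, x)), ?_, ?_, ?_⟩
          · rintro c ⟨σ, hσ, -, rfl⟩
            exact integral_nonneg fun x => by positivity
          · rw [Measure.map_map measurable_fst (by fun_prop)]
            exact Measure.map_id
          · rw [Measure.map_map measurable_snd (by fun_prop)]
            exact Measure.map_id
          · rw [integral_map (by fun_prop) (meas_d r).aestronglyMeasurable]
            simp [Real.zero_rpow (show r ≠ 0 by linarith)]
        simp [this]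
      simpa using hWself
  have hpow : Tendsto (fun ε : ℝ => ε ^ r) (𝓝[>] 0) (𝓝 0) := by
    have h := (Real.continuousAt_rpow_const 0 r (Or.inr (by linarith))).tendsto
    rw [Real.zero_rpow (by linarith)] at h
    exact h.mono_left nhdsWithin_le_nhds
  have htot := hpow.add ((hI.add hIμ).const_mul (2 ^ r))
  rw [add_zero, mul_zero, add_zero] at htot
  rw [Metric.tendsto_nhds]
  intro η hη
  obtain ⟨δ, hδ1, hδ0⟩ := ((htot.eventually (gt_mem_nhds hη)).and self_mem_nhdsWithin).exists
  have hδ0' : 0 < δ := hδ0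
  filter_upwards [exists_subcoupling μ μk hweak hδ0'] with k hk
  obtain ⟨S, h1, h2, h3, h4⟩ := hk
  rw [Real.dist_eq, sub_zero, abs_of_nonneg (WrRpow_nonneg _ _ _)]
  refine lt_of_le_of_lt ?_ hδ1
  refine (WrRpow_le hr x₀ (μk k) μ (hmomk k) hmom S h1 h2 hδ0'.le h3 h4).trans ?_
  have hb : BddAbove (range fun k => Ieps r x₀ (μk k) δ) := by
    refine ⟨C, ?_⟩
    rintro _ ⟨j, rfl⟩
    refine le_trans ?_ (hC j)
    refine csSup_le ⟨0, 0, Measure.zero_le _, by simp, by simp⟩ ?_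
    rintro c ⟨σ, hσ, -, rfl⟩
    exact integral_mono_measure hσ (Eventually.of_forall fun x => by positivity) (hmomk j)
  have := le_ciSup hb k
  gcongr

end WassAux

/-- For probability measures `μ^k` converging weakly to `μ`, all with finite `r`-th moments,
`W_r(μ^k, μ) → 0` iff `sup_k I^r_ε(μ^k) → 0` as `ε → 0` and the `r`-th moments of the `μ^k`
are uniformly bounded. -/
theorem stmt8 {X : Type*} [MetricSpace X] [CompleteSpace X]
    [SecondCountableTopology X] [MeasurableSpace X] [BorelSpace X]
    (r : ℝ) (hr : 1 ≤ r) (x₀ : X)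
    (μ : Measure X) (μk : ℕ → Measure X)
    [IsProbabilityMeasure μ] [∀ k, IsProbabilityMeasure (μk k)]
    (hmom : Integrable (fun x => dist x x₀ ^ r) μ)
    (hmomk : ∀ k, Integrable (fun x => dist x x₀ ^ r) (μk k))
    (hweak : ∀ f : BoundedContinuousFunction X ℝ,
      Filter.Tendsto (fun k => ∫ x, f x ∂(μk k)) Filter.atTop (nhds (∫ x, f x ∂μ))) :
    Filter.Tendsto (fun k => WrRpow r (μk k) μ) Filter.atTop (nhds 0) ↔
      (Filter.Tendsto (fun ε => ⨆ k, Ieps r x₀ (μk k) ε)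
          (nhdsWithin 0 (Set.Ioi 0)) (nhds 0) ∧
        ∃ C : ℝ, ∀ k, ∫ x, dist x x₀ ^ r ∂(μk k) ≤ C) := by
  constructor
  · intro h
    exact WassAux.forward r hr x₀ μ μk hmom hmomk h
  · rintro ⟨h1, h2⟩
    exact WassAux.backward r hr x₀ μ μk hmom hmomk hweak h1 h2
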